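/- arXiv:2502.03749 — 4 statements merged into one kernel-verified Lean document; each statement's English description precedes it below -/
import Mathlib

section
/- Let η > 0, let X^k ∈ 𝒫 have strictly positive entries, and suppose X^{k+1} ∈ 𝒫 has strictly positive entries and minimizes the function X ↦ ⟨C,X⟩ + η·D_φ(X,X^k) over 𝒫. Then for every P ∈ 𝒫: ⟨C, X^{k+1}⟩ ≤ ⟨C, P⟩ + η·(D_φ(P,X^k) − D_φ(P,X^{k+1}) − D_φ(X^{k+1},X^k)). -/
open scoped BigOperators

/-- The Boltzmann–Shannon entropy kernel `φ(X) = Σ_{i,j} X_{ij} (log X_{ij} − 1)`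
(with the convention `0 · log 0 = 0`, which agrees with `Real.log 0 = 0`). -/
noncomputable def phi {m n : ℕ} (X : Matrix (Fin m) (Fin n) ℝ) : ℝ :=
  ∑ i, ∑ j, X i j * (Real.log (X i j) - 1)

/-- The Bregman distance associated with `φ`:
`D_φ(X,Y) = φ(X) − φ(Y) − Σ_{i,j} (log Y_{ij}) (X_{ij} − Y_{ij})`. -/
noncomputable def bregman {m n : ℕ} (X Y : Matrix (Fin m) (Fin n) ℝ) : ℝ :=
  phi X - phi Y - ∑ i, ∑ j, Real.log (Y i j) * (X i j - Y i j)

/-- The trace inner product `⟨A,B⟩ = Σ_{i,j} A_{ij} B_{ij}`. -/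
def inprod {m n : ℕ} (A B : Matrix (Fin m) (Fin n) ℝ) : ℝ :=
  ∑ i, ∑ j, A i j * B i j

/-- The transport polytope
`𝒫 = {X : X_{ij} ≥ 0, X e_n = a, Xᵀ e_m = b}` (row sums `a`, column sums `b`). -/
def Pset {m n : ℕ} (a : Fin m → ℝ) (b : Fin n → ℝ) : Set (Matrix (Fin m) (Fin n) ℝ) :=
  {X | (∀ i j, 0 ≤ X i j) ∧ (∀ i, ∑ j, X i j = a i) ∧ (∀ j, ∑ i, X i j = b j)}

/-- Three-point identity for the entropic Bregman distance. -/
theorem bregman_three_point {m n : ℕ} (P X Y : Matrix (Fin m) (Fin n) ℝ) :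
    bregman P Y - bregman P X - bregman X Y =
      ∑ i, ∑ j, (Real.log (X i j) - Real.log (Y i j)) * (P i j - X i j) := by
  simp only [bregman, mul_sub, sub_mul, Finset.sum_sub_distrib]
  ring

/-- A line through a positive entry of a matrix stays positive for small parameters, in all entries
at once. -/
theorem eventually_forall_add_mul_pos {m n : ℕ} {X : Matrix (Fin m) (Fin n) ℝ}
    (hX : ∀ i j, 0 < X i j) (d : Matrix (Fin m) (Fin n) ℝ) :
    ∀ᶠ t in nhds (0 : ℝ), ∀ i j, 0 < X i j + t * d i j := by
  simp only [Filter.eventually_all]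
  intro i j
  have hc : Continuous fun t : ℝ => X i j + t * d i j := by fun_prop
  exact hc.continuousAt.eventually_const_lt (by simpa using hX i j)

/-- Affine combinations of points of the transport polytope stay in it as long as they are
entrywise nonnegative. -/
theorem add_mul_sub_mem_Pset {m n : ℕ} {a : Fin m → ℝ} {b : Fin n → ℝ}
    {X P : Matrix (Fin m) (Fin n) ℝ} (hX : X ∈ Pset a b) (hP : P ∈ Pset a b) {t : ℝ}
    (ht : ∀ i j, 0 ≤ X i j + t * (P i j - X i j)) :
    (fun i j => X i j + t * (P i j - X i j)) ∈ Pset a b := by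
  refine ⟨ht, fun i => ?_, fun j => ?_⟩
  · simp [Finset.sum_add_distrib, ← Finset.mul_sum, hX.2.1 i, hP.2.1 i]
  · simp [Finset.sum_add_distrib, ← Finset.mul_sum, hX.2.2 j, hP.2.2 j]

/-- Directional derivative of `⟨C, X⟩ + η D_φ(X, Y)` at a positive matrix `X`. -/
theorem hasDerivAt_inprod_add_bregman {m n : ℕ} (C Y d : Matrix (Fin m) (Fin n) ℝ) (η : ℝ)
    {X : Matrix (Fin m) (Fin n) ℝ} (hX : ∀ i j, 0 < X i j) :
    HasDerivAt (fun t : ℝ => inprod C (fun i j => X i j + t * d i j) +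
        η * bregman (fun i j => X i j + t * d i j) Y)
      (∑ i, ∑ j, C i j * d i j +
        η * ∑ i, ∑ j, (Real.log (X i j) - Real.log (Y i j)) * d i j) 0 := by
  have hline (i : Fin m) (j : Fin n) : HasDerivAt (fun t : ℝ => X i j + t * d i j) (d i j) 0 := by
    simpa using ((hasDerivAt_id (0 : ℝ)).mul_const (d i j)).const_add (X i j)
  have hlin (A : Matrix (Fin m) (Fin n) ℝ) (i : Fin m) (j : Fin n) :
      HasDerivAt (fun t : ℝ => A i j * (X i j + t * d i j)) (A i j * d i j) 0 :=
    (hline i j).const_mul _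
  have hent (i : Fin m) (j : Fin n) :
      HasDerivAt (fun t : ℝ => (X i j + t * d i j) * (Real.log (X i j + t * d i j) - 1))
        (Real.log (X i j) * d i j) 0 := by
    have hne : X i j ≠ 0 := (hX i j).ne'
    refine ((hline i j).mul (((hline i j).log (by simpa using hne)).sub_const 1)).congr_deriv ?_
    simp only [zero_mul, add_zero]
    field_simp
    ring
  have hlog (i : Fin m) (j : Fin n) :
      HasDerivAt (fun t : ℝ => Real.log (Y i j) * (X i j + t * d i j - Y i j))
        (Real.log (Y i j) * d i j) 0 :=
    ((hline i j).sub_const _).const_mul _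
  have hsum {f : Fin m → Fin n → ℝ → ℝ} {f' : Fin m → Fin n → ℝ}
      (h : ∀ i j, HasDerivAt (f i j) (f' i j) 0) :
      HasDerivAt (fun t => ∑ i, ∑ j, f i j t) (∑ i, ∑ j, f' i j) 0 :=
    HasDerivAt.fun_sum fun i _ => HasDerivAt.fun_sum fun j _ => h i j
  refine ((hsum (hlin C)).add
    ((((hsum hent).sub_const (phi Y)).sub (hsum hlog)).const_mul η)).congr_deriv ?_
  simp only [sub_mul, Finset.sum_sub_distrib]

/-- Key inequality for the entropic proximal step: if `X^{k+1}` minimizes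
`X ↦ ⟨C,X⟩ + η D_φ(X, X^k)` over `𝒫`, then for every `P ∈ 𝒫`,
`⟨C, X^{k+1}⟩ ≤ ⟨C, P⟩ + η (D_φ(P,X^k) − D_φ(P,X^{k+1}) − D_φ(X^{k+1},X^k))`. -/
theorem stmt_3 {m n : ℕ} (hm : 0 < m) (hn : 0 < n)
    (a : Fin m → ℝ) (b : Fin n → ℝ)
    (ha : ∀ i, 0 < a i) (hb : ∀ j, 0 < b j)
    (hasum : ∑ i, a i = 1) (hbsum : ∑ j, b j = 1)
    (C : Matrix (Fin m) (Fin n) ℝ) (η : ℝ) (hη : 0 < η)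
    (Xk Xkp1 : Matrix (Fin m) (Fin n) ℝ)
    (hXkP : Xk ∈ Pset a b) (hXkpos : ∀ i j, 0 < Xk i j)
    (hXkp1P : Xkp1 ∈ Pset a b) (hXkp1pos : ∀ i j, 0 < Xkp1 i j)
    (hmin : ∀ X ∈ Pset a b,
      inprod C Xkp1 + η * bregman Xkp1 Xk ≤ inprod C X + η * bregman X Xk) :
    ∀ P ∈ Pset a b,
      inprod C Xkp1 ≤ inprod C P
        + η * (bregman P Xk - bregman P Xkp1 - bregman Xkp1 Xk) := by
  intro P hP
  have hloc : IsLocalMin (fun t : ℝ =>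
      inprod C (fun i j => Xkp1 i j + t * (P - Xkp1) i j) +
        η * bregman (fun i j => Xkp1 i j + t * (P - Xkp1) i j) Xk) 0 := by
    filter_upwards [eventually_forall_add_mul_pos hXkp1pos (P - Xkp1)] with t ht
    simpa using hmin _ (add_mul_sub_mem_Pset hXkp1P hP fun i j => (ht i j).le)
  have hzero := hloc.hasDerivAt_eq_zero
    (hasDerivAt_inprod_add_bregman C Xk (P - Xkp1) η hXkp1pos)
  have hC : ∑ i, ∑ j, C i j * (P - Xkp1) i j = inprod C P - inprod C Xkp1 := by
    simp only [inprod, Matrix.sub_apply, mul_sub, Finset.sum_sub_distrib]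
  rw [hC] at hzero
  simp only [Matrix.sub_apply] at hzero
  rw [bregman_three_point]
  linarith
end

section
/- (Global convergence of the entropic proximal point iterations.) Let η > 0 and let (X^k)_{k≥0} be a sequence in 𝒫 such that every X^k has strictly positive entries and, for each k, X^{k+1} minimizes the function X ↦ ⟨C,X⟩ + η·D_φ(X,X^k) over 𝒫. Then ⟨C, X^k⟩ converges to c* := min_{X∈𝒫} ⟨C,X⟩ as k → ∞, and every limit point of the sequence (X^k) is a minimizer of ⟨C,·⟩ over 𝒫. -/
open scoped BigOperators

/-- The scalar Kullback–Leibler term of which `bregman` is the entrywise sum. -/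
noncomputable def klTerm (z x : ℝ) : ℝ :=
  z * Real.log z - z * Real.log x - z + x

theorem klTerm_nonneg {z x : ℝ} (hz : 0 ≤ z) (hx : 0 < x) : 0 ≤ klTerm z x := by
  unfold klTerm
  rcases hz.eq_or_lt with rfl | hz
  · simpa using hx.le
  · have h := Real.log_le_sub_one_of_pos (div_pos hx hz)
    rw [Real.log_div hx.ne' hz.ne'] at h
    have h' := mul_le_mul_of_nonneg_left h hz.le
    have e : z * (x / z - 1) = x - z := by field_simp
    rw [e] at h'
    linarith

theorem klTerm_le_sq_div {z x : ℝ} (hz : 0 ≤ z) (hx : 0 < x) :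
    klTerm z x ≤ (z - x) ^ 2 / x := by
  unfold klTerm
  rcases hz.eq_or_lt with rfl | hz
  · apply le_of_eq
    field_simp
    ring
  · have h := Real.log_le_sub_one_of_pos (div_pos hz hx)
    rw [Real.log_div hz.ne' hx.ne'] at h
    have h' := mul_le_mul_of_nonneg_left h hz.le
    have e : (z - x) ^ 2 / x = z * (z / x - 1) - z + x := by
      field_simp
      ring
    rw [e]
    linarith

section

variable {m n : ℕ}

theorem bregman_eq_sum_klTerm (X Y : Matrix (Fin m) (Fin n) ℝ) :
    bregman X Y = ∑ i, ∑ j, klTerm (X i j) (Y i j) := by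
  simp only [bregman, phi, klTerm, ← Finset.sum_sub_distrib]
  refine Finset.sum_congr rfl fun i _ => Finset.sum_congr rfl fun j _ => ?_
  ring

theorem bregman_nonneg {X Y : Matrix (Fin m) (Fin n) ℝ} (hX : ∀ i j, 0 ≤ X i j)
    (hY : ∀ i j, 0 < Y i j) : 0 ≤ bregman X Y := by
  rw [bregman_eq_sum_klTerm]
  exact Finset.sum_nonneg fun i _ => Finset.sum_nonneg fun j _ => klTerm_nonneg (hX i j) (hY i j)

theorem bregman_le_sum_sq_div {X Y : Matrix (Fin m) (Fin n) ℝ} (hX : ∀ i j, 0 ≤ X i j)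
    (hY : ∀ i j, 0 < Y i j) : bregman X Y ≤ ∑ i, ∑ j, (X i j - Y i j) ^ 2 / Y i j := by
  rw [bregman_eq_sum_klTerm]
  exact Finset.sum_le_sum fun i _ => Finset.sum_le_sum fun j _ =>
    klTerm_le_sq_div (hX i j) (hY i j)

/-- The three-point identity for the Bregman distance. -/
theorem bregman_three_point_s6 (Z V W : Matrix (Fin m) (Fin n) ℝ) :
    bregman Z W = bregman V W + bregman Z V +
      inprod (fun i j => Real.log (V i j) - Real.log (W i j)) (Z - V) := by
  simp only [bregman_eq_sum_klTerm, inprod, klTerm, ← Finset.sum_add_distrib, Matrix.sub_apply]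
  refine Finset.sum_congr rfl fun i _ => Finset.sum_congr rfl fun j _ => ?_
  ring

theorem inprod_add_right (A B D : Matrix (Fin m) (Fin n) ℝ) :
    inprod A (B + D) = inprod A B + inprod A D := by
  simp [inprod, mul_add, Finset.sum_add_distrib]

theorem inprod_smul_right (A B : Matrix (Fin m) (Fin n) ℝ) (t : ℝ) :
    inprod A (t • B) = t * inprod A B := by
  simp only [inprod, Finset.mul_sum, Matrix.smul_apply, smul_eq_mul]
  refine Finset.sum_congr rfl fun i _ => Finset.sum_congr rfl fun j _ => ?_
  ring

theorem continuous_inprod_right (A : Matrix (Fin m) (Fin n) ℝ) :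
    Continuous fun Y => inprod A Y := by
  unfold inprod
  fun_prop

theorem isClosed_Pset (a : Fin m → ℝ) (b : Fin n → ℝ) : IsClosed (Pset a b) := by
  simp only [Pset, Set.ofPred_and, Set.ofPred_forall]
  refine .inter ?_ (.inter ?_ ?_)
  · exact isClosed_iInter fun i => isClosed_iInter fun j =>
      isClosed_le continuous_const (by fun_prop)
  · exact isClosed_iInter fun i => isClosed_eq (by fun_prop) continuous_const
  · exact isClosed_iInter fun j => isClosed_eq (by fun_prop) continuous_const

theorem add_smul_sub_mem_Pset {a : Fin m → ℝ} {b : Fin n → ℝ}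
    {V Y : Matrix (Fin m) (Fin n) ℝ} (hV : V ∈ Pset a b) (hY : Y ∈ Pset a b)
    {t : ℝ} (ht₀ : 0 ≤ t) (ht₁ : t ≤ 1) : V + t • (Y - V) ∈ Pset a b := by
  obtain ⟨hV₀, hVa, hVb⟩ := hV
  obtain ⟨hY₀, hYa, hYb⟩ := hY
  refine ⟨fun i j => ?_, fun i => ?_, fun j => ?_⟩
  · have h₁ := mul_nonneg (sub_nonneg.2 ht₁) (hV₀ i j)
    have h₂ := mul_nonneg ht₀ (hY₀ i j)
    simp only [Matrix.add_apply, Matrix.smul_apply, Matrix.sub_apply, smul_eq_mul]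
    linarith
  · simp [Finset.sum_add_distrib, ← Finset.mul_sum, hVa, hYa]
  · simp [Finset.sum_add_distrib, ← Finset.mul_sum, hVb, hYb]

theorem nonneg_of_forall_add_mul_sq_nonneg {g K : ℝ}
    (h : ∀ t : ℝ, 0 < t → t ≤ 1 → 0 ≤ t * g + t ^ 2 * K) : 0 ≤ g := by
  have h' : ∀ᶠ t : ℝ in nhdsWithin 0 (Set.Ioi 0), 0 ≤ g + t * K := by
    filter_upwards [Ioc_mem_nhdsGT (zero_lt_one' ℝ)] with t ht
    refine nonneg_of_mul_nonneg_right (a := t) ?_ ht.1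
    linarith [h t ht.1 ht.2]
  have lim : Filter.Tendsto (fun t : ℝ => g + t * K) (nhdsWithin 0 (Set.Ioi 0)) (nhds g) := by
    have : Continuous fun t : ℝ => g + t * K := by fun_prop
    simpa using (this.tendsto 0).mono_left nhdsWithin_le_nhds
  exact ge_of_tendsto lim h'

/-- The descent inequality satisfied by a positive minimizer `V` of the proximal subproblem
centred at `W`. -/
theorem prox_descent {a : Fin m → ℝ} {b : Fin n → ℝ} {C V W : Matrix (Fin m) (Fin n) ℝ}
    {η : ℝ} (hη : 0 < η) (hV : V ∈ Pset a b) (hVpos : ∀ i j, 0 < V i j)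
    (hmin : ∀ Y ∈ Pset a b, inprod C V + η * bregman V W ≤ inprod C Y + η * bregman Y W)
    {Y : Matrix (Fin m) (Fin n) ℝ} (hY : Y ∈ Pset a b) :
    inprod C V + η * bregman V W + η * bregman Y V ≤ inprod C Y + η * bregman Y W := by
  set G : Matrix (Fin m) (Fin n) ℝ := fun i j => Real.log (V i j) - Real.log (W i j) with hG
  have key : 0 ≤ inprod C (Y - V) + η * inprod G (Y - V) := by
    refine nonneg_of_forall_add_mul_sq_nonneg
      (K := η * ∑ i, ∑ j, (Y i j - V i j) ^ 2 / V i j) fun t ht₀ ht₁ => ?_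
    have hZ := add_smul_sub_mem_Pset hV hY ht₀.le ht₁
    have h₁ := hmin _ hZ
    have h₂ := mul_le_mul_of_nonneg_left (bregman_le_sum_sq_div hZ.1 hVpos) hη.le
    have e : ∑ i, ∑ j, ((V + t • (Y - V)) i j - V i j) ^ 2 / V i j =
        t ^ 2 * ∑ i, ∑ j, (Y i j - V i j) ^ 2 / V i j := by
      simp only [Finset.mul_sum]
      refine Finset.sum_congr rfl fun i _ => Finset.sum_congr rfl fun j _ => ?_
      simp only [Matrix.add_apply, Matrix.smul_apply, Matrix.sub_apply, smul_eq_mul]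
      ring
    rw [e] at h₂
    rw [bregman_three_point_s6 (V + t • (Y - V)) V W, ← hG, inprod_add_right, add_sub_cancel_left,
      inprod_smul_right, inprod_smul_right] at h₁
    linarith
  have hC : inprod C Y = inprod C V + inprod C (Y - V) := by
    rw [← inprod_add_right, add_sub_cancel]
  rw [bregman_three_point_s6 Y V W, ← hG, hC]
  linarith

end

/-- Global convergence of the entropic proximal point iterations: if each `X^{k+1}`
minimizes `X ↦ ⟨C,X⟩ + η D_φ(X, X^k)` over `𝒫`, then `⟨C, X^k⟩ → c* = min_{X∈𝒫}⟨C,X⟩`,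
and every limit point of `(X^k)` minimizes `⟨C,·⟩` over `𝒫`. -/
theorem stmt_6 {m n : ℕ} (hm : 0 < m) (hn : 0 < n)
    (a : Fin m → ℝ) (b : Fin n → ℝ)
    (ha : ∀ i, 0 < a i) (hb : ∀ j, 0 < b j)
    (hasum : ∑ i, a i = 1) (hbsum : ∑ j, b j = 1)
    (C : Matrix (Fin m) (Fin n) ℝ) (η : ℝ) (hη : 0 < η)
    (X : ℕ → Matrix (Fin m) (Fin n) ℝ)
    (hXP : ∀ k, X k ∈ Pset a b) (hXpos : ∀ k i j, 0 < X k i j)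
    (hmin : ∀ k, ∀ Y ∈ Pset a b,
      inprod C (X (k + 1)) + η * bregman (X (k + 1)) (X k)
        ≤ inprod C Y + η * bregman Y (X k))
    (cstar : ℝ) (hc : IsLeast ((fun Y => inprod C Y) '' Pset a b) cstar) :
    Filter.Tendsto (fun k => inprod C (X k)) Filter.atTop (nhds cstar) ∧
    ∀ L : Matrix (Fin m) (Fin n) ℝ, MapClusterPt L Filter.atTop X →
      L ∈ Pset a b ∧ inprod C L = cstar := by
  obtain ⟨⟨Y, hY, rfl⟩, hlb⟩ := hc
  have hle : ∀ k, inprod C Y ≤ inprod C (X k) := fun k => hlb ⟨X k, hXP k, rfl⟩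
  have step : ∀ k, inprod C (X (k + 1)) - inprod C Y ≤
      η * bregman Y (X k) - η * bregman Y (X (k + 1)) := fun k => by
    have h₁ := prox_descent hη (hXP (k + 1)) (hXpos (k + 1)) (hmin k) hY
    have h₂ := mul_nonneg hη.le (bregman_nonneg (hXP (k + 1)).1 (hXpos k))
    linarith
  have hsummable : Summable fun k => inprod C (X (k + 1)) - inprod C Y := by
    refine summable_of_sum_range_le (c := η * bregman Y (X 0))
      (fun k => sub_nonneg.2 (hle _)) fun N => ?_
    refine (Finset.sum_le_sum fun k _ => step k).trans ?_
    rw [Finset.sum_range_sub' fun k => η * bregman Y (X k)]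
    linarith [mul_nonneg hη.le (bregman_nonneg hY.1 (hXpos N))]
  have hlim : Filter.Tendsto (fun k => inprod C (X k)) Filter.atTop (nhds (inprod C Y)) := by
    rw [← Filter.tendsto_add_atTop_iff_nat 1]
    simpa using hsummable.tendsto_atTop_zero.add_const (inprod C Y)
  refine ⟨hlim, fun L hL => ⟨?_, ?_⟩⟩
  · exact (isClosed_Pset a b).closure_subset
      (hL.clusterPt.mem_closure_of_mem _ (Filter.mem_map.2 (Filter.Eventually.of_forall hXP)))
  · have hcl := hL.continuousAt_comp (continuous_inprod_right C).continuousAt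
    exact (eq_of_nhds_neBot (hcl.neBot.mono (inf_le_inf_left _ hlim)))
end

section
/- Let η > 0, C ∈ ℝ^{m×n}, f ∈ ℝ^m, g ∈ ℝ^n. The function L(X) := ⟨C,X⟩ + η·Σ_{i,j} X_{ij} log X_{ij} + ⟨f, a − X e_n⟩ + ⟨g, b − X^⊤ e_m⟩, defined on matrices X with strictly positive entries, attains its infimum at the unique point X(f,g) given by X(f,g)_{ij} = exp((f_i + g_j − C_{ij})/η − 1); that is, L(X(f,g)) < L(X) for every X with strictly positive entries, X ≠ X(f,g). -/
open scoped BigOperators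

/-- The Lagrangian of the entropic regularized OT problem:
`L(X) = ⟨C,X⟩ + η Σ_{i,j} X_{ij} log X_{ij} + ⟨f, a − X e_n⟩ + ⟨g, b − Xᵀ e_m⟩`. -/
noncomputable def Lag {m n : ℕ} (a : Fin m → ℝ) (b : Fin n → ℝ)
    (C : Matrix (Fin m) (Fin n) ℝ) (η : ℝ) (f : Fin m → ℝ) (g : Fin n → ℝ)
    (X : Matrix (Fin m) (Fin n) ℝ) : ℝ :=
  (∑ i, ∑ j, C i j * X i j) + η * ∑ i, ∑ j, X i j * Real.log (X i j)
    + (∑ i, f i * (a i - ∑ j, X i j)) + (∑ j, g j * (b j - ∑ i, X i j))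

/-- Fenchel–Young inequality for the entropy, strict away from the optimum. -/
lemma neg_exp_lt_mul_log_sub {x t : ℝ} (hx : 0 < x) (hxt : x ≠ Real.exp t) :
    -Real.exp t < x * Real.log x - x * (t + 1) := by
  have hu : t - Real.log x ≠ 0 := fun h => hxt (by rw [sub_eq_zero.mp h, Real.exp_log hx])
  have h := Real.add_one_lt_exp hu
  rw [Real.exp_sub, Real.exp_log hx, lt_div_iff₀ hx] at h
  linarith

/-- The Lagrangian is separable in the entries of `X`, up to an additive constant. -/
lemma Lag_eq_const_add_sum {m n : ℕ} (a : Fin m → ℝ) (b : Fin n → ℝ)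
    (C : Matrix (Fin m) (Fin n) ℝ) {η : ℝ} (hη : η ≠ 0) (f : Fin m → ℝ) (g : Fin n → ℝ)
    (X : Matrix (Fin m) (Fin n) ℝ) :
    Lag a b C η f g X = (∑ i, f i * a i + ∑ j, g j * b j) +
      ∑ i, ∑ j, η * (X i j * Real.log (X i j)
        - X i j * (((f i + g j - C i j) / η - 1) + 1)) := by
  have hterm : ∀ i j, η * (X i j * Real.log (X i j)
        - X i j * (((f i + g j - C i j) / η - 1) + 1)) =
      C i j * X i j + η * (X i j * Real.log (X i j)) - f i * X i j - g j * X i j := by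
    intro i j
    field_simp
    ring
  have hcomm : ∑ j, ∑ i, g j * X i j = ∑ i, ∑ j, g j * X i j := Finset.sum_comm
  simp only [Lag, hterm, mul_sub, Finset.sum_sub_distrib, Finset.sum_add_distrib,
    Finset.mul_sum, hcomm]
  ring

/-- Over matrices with strictly positive entries, the Lagrangian attains its infimum
at the unique point `X(f,g)_{ij} = exp((f_i + g_j − C_{ij})/η − 1)`: it is strictly
smaller at `X(f,g)` than at any other positive matrix. -/
theorem stmt_8 {m n : ℕ} (hm : 0 < m) (hn : 0 < n)
    (a : Fin m → ℝ) (b : Fin n → ℝ) (C : Matrix (Fin m) (Fin n) ℝ)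
    (η : ℝ) (hη : 0 < η) (f : Fin m → ℝ) (g : Fin n → ℝ) :
    ∀ X : Matrix (Fin m) (Fin n) ℝ, (∀ i j, 0 < X i j) →
      X ≠ Matrix.of (fun i j => Real.exp ((f i + g j - C i j) / η - 1)) →
      Lag a b C η f g (Matrix.of fun i j => Real.exp ((f i + g j - C i j) / η - 1))
        < Lag a b C η f g X := by
  intro X hX hne
  rw [Lag_eq_const_add_sum a b C hη.ne', Lag_eq_const_add_sum a b C hη.ne']
  have hval : ∀ t : ℝ, Real.exp t * t - Real.exp t * (t + 1) = -Real.exp t := fun t => by ring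
  simp only [Matrix.of_apply, Real.log_exp, hval]
  obtain ⟨i₀, j₀, hij⟩ : ∃ i j, X i j ≠ Real.exp ((f i + g j - C i j) / η - 1) := by
    by_contra! h
    exact hne (Matrix.ext h)
  have hle : ∀ i j, η * -Real.exp ((f i + g j - C i j) / η - 1) ≤
      η * (X i j * Real.log (X i j) - X i j * (((f i + g j - C i j) / η - 1) + 1)) := by
    intro i j
    by_cases h : X i j = Real.exp ((f i + g j - C i j) / η - 1)
    · rw [h, Real.log_exp, hval]
    · exact mul_le_mul_of_nonneg_left (neg_exp_lt_mul_log_sub (hX i j) h).le hη.le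
  refine add_lt_add_right (Finset.sum_lt_sum (fun i _ => Finset.sum_le_sum fun j _ => hle i j)
    ⟨i₀, Finset.mem_univ _, Finset.sum_lt_sum (fun j _ => hle i₀ j) ⟨j₀, Finset.mem_univ _, ?_⟩⟩) _
  exact mul_lt_mul_of_pos_left (neg_exp_lt_mul_log_sub (hX i₀ j₀) hij) hη
end

section
/- (Core sparse-approximation bound of Theorem 2.) Let η > 0 with η ≤ Δ/(1 + log(mn)), let X*(η) be the unique minimizer of X ↦ ⟨C,X⟩ + η·Σ_{i,j} X_{ij} log X_{ij} over 𝒫, and let X̃ ∈ ℝ^{m×n} be arbitrary. Then there exists Y ∈ 𝒳 such that ‖X̃ − Y‖_1 ≤ ‖X̃ − X*(η)‖_1 + 6mn·exp(−Δ/η). If moreover 𝒳 consists of a single point X*, then Y = X* and Y has at most m + n − 1 nonzero entries. -/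
open scoped BigOperators

/-- The convex join of two compact sets is compact. -/
lemma IsCompact.convexJoin {E : Type*} [AddCommGroup E] [Module ℝ E] [TopologicalSpace E]
    [ContinuousAdd E] [ContinuousSMul ℝ E] {s t : Set E} (hs : IsCompact s) (ht : IsCompact t) :
    IsCompact (convexJoin ℝ s t) := by
  have h := ((isCompact_Icc (a := (0 : ℝ)) (b := 1)).prod (hs.prod ht)).image
    (f := fun p : ℝ × E × E => (1 - p.1) • p.2.1 + p.1 • p.2.2) (by fun_prop)
  convert h using 1
  ext x
  simp only [mem_convexJoin, segment_eq_image, Set.mem_image, Set.mem_prod, Prod.exists]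
  constructor
  · rintro ⟨y, hy, z, hz, θ, hθ, rfl⟩
    exact ⟨θ, y, z, ⟨hθ, hy, hz⟩, rfl⟩
  · rintro ⟨θ, y, z, ⟨hθ, hy, hz⟩, rfl⟩
    exact ⟨y, hy, z, hz, θ, hθ, rfl⟩

/-- If a continuous linear functional takes on the extreme points of a compact convex set only
the value `c` or values at least `d`, then the set is the join of its level set at `c` and its
superlevel set at `d`. -/
lemma exists_segment_of_extremePoints {E : Type*} [AddCommGroup E] [Module ℝ E]
    [TopologicalSpace E] [T2Space E] [IsTopologicalAddGroup E] [ContinuousSMul ℝ E]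
    [LocallyConvexSpace ℝ E] {s : Set E} (hs : IsCompact s) (hconv : Convex ℝ s)
    (f : E →L[ℝ] ℝ) {c d : ℝ} (hext : ∀ v ∈ s.extremePoints ℝ, f v = c ∨ d ≤ f v)
    (hc : ∃ x ∈ s, f x = c) (hd : ∃ x ∈ s, d ≤ f x) {x : E} (hx : x ∈ s) :
    ∃ y ∈ s, f y = c ∧ ∃ z ∈ s, d ≤ f z ∧ x ∈ segment ℝ y z := by
  have hFconv : Convex ℝ (s ∩ {x | f x = c}) :=
    hconv.inter (convex_hyperplane f.toLinearMap.isLinear c)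
  have hGconv : Convex ℝ (s ∩ {x | d ≤ f x}) :=
    hconv.inter (convex_halfSpace_ge f.toLinearMap.isLinear d)
  have hF : IsCompact (s ∩ {x | f x = c}) :=
    hs.inter_right (isClosed_eq f.continuous continuous_const)
  have hG : IsCompact (s ∩ {x | d ≤ f x}) :=
    hs.inter_right (isClosed_le continuous_const f.continuous)
  have hsub : closure (convexHull ℝ (s.extremePoints ℝ)) ⊆
      convexJoin ℝ (s ∩ {x | f x = c}) (s ∩ {x | d ≤ f x}) := by
    refine closure_minimal (convexHull_min (fun v hv => ?_) (hFconv.convexJoin hGconv))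
      (hF.convexJoin hG).isClosed
    rcases hext v hv with h | h
    · exact subset_convexJoin_left hd ⟨extremePoints_subset hv, h⟩
    · exact subset_convexJoin_right hc ⟨extremePoints_subset hv, h⟩
  rw [closure_convexHull_extremePoints hs hconv] at hsub
  obtain ⟨y, ⟨hy, hyc⟩, z, ⟨hz, hzd⟩, hseg⟩ := mem_convexJoin.1 (hsub hx)
  exact ⟨y, hy, hyc, z, hz, hzd, hseg⟩

namespace Real

lemma negMulLog_add_le {s t : ℝ} (hs : 0 ≤ s) (ht : 0 ≤ t) :
    negMulLog (s + t) ≤ negMulLog s + negMulLog t := by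
  rcases hs.eq_or_lt with rfl | hs
  · simp
  rcases ht.eq_or_lt with rfl | ht
  · simp
  have h₁ : log s ≤ log (s + t) := log_le_log hs (by linarith)
  have h₂ : log t ≤ log (s + t) := log_le_log ht (by linarith)
  simp only [negMulLog]
  nlinarith [mul_le_mul_of_nonneg_left h₁ hs.le, mul_le_mul_of_nonneg_left h₂ ht.le]

/-- The Shannon entropy of a probability vector is at most the logarithm of its length. -/
lemma sum_negMulLog_le_log_card {ι : Type*} [Fintype ι] {p : ι → ℝ} (hp : ∀ i, 0 ≤ p i)
    (hsum : ∑ i, p i = 1) : ∑ i, negMulLog (p i) ≤ log (Fintype.card ι) := by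
  have hne : Nonempty ι := by
    by_contra h
    rw [not_nonempty_iff] at h
    simp at hsum
  have hN : (0 : ℝ) < Fintype.card ι := by exact_mod_cast Fintype.card_pos
  have key : ∀ i, negMulLog (p i) ≤
      p i * log (Fintype.card ι) + ((Fintype.card ι : ℝ)⁻¹ - p i) := by
    intro i
    have h := mul_le_mul_of_nonneg_left
      (negMulLog_le_one_sub_self (mul_nonneg hN.le (hp i))) (inv_nonneg.2 hN.le)
    rw [negMulLog_mul] at h
    simp only [negMulLog] at h ⊢
    field_simp at h ⊢
    linarith
  calc ∑ i, negMulLog (p i)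
      ≤ ∑ i, (p i * log (Fintype.card ι) + ((Fintype.card ι : ℝ)⁻¹ - p i)) :=
        Finset.sum_le_sum fun i _ => key i
    _ = log (Fintype.card ι) := by
        rw [Finset.sum_add_distrib, Finset.sum_sub_distrib, ← Finset.sum_mul, hsum]
        simp [hN.ne']

/-- The entropy of a mixture exceeds the mixture of the entropies by at most the binary entropy
of the mixing weight. -/
lemma sum_negMulLog_mix_le {ι : Type*} [Fintype ι] {p q : ι → ℝ} (hp : ∀ i, 0 ≤ p i)
    (hq : ∀ i, 0 ≤ q i) (hpsum : ∑ i, p i = 1) (hqsum : ∑ i, q i = 1) {s t : ℝ} (hs : 0 ≤ s)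
    (ht : 0 ≤ t) :
    ∑ i, negMulLog (s * p i + t * q i) ≤
      s * ∑ i, negMulLog (p i) + t * ∑ i, negMulLog (q i) + negMulLog s + negMulLog t := by
  calc ∑ i, negMulLog (s * p i + t * q i)
      ≤ ∑ i, ((p i * negMulLog s + s * negMulLog (p i)) +
          (q i * negMulLog t + t * negMulLog (q i))) := by
        refine Finset.sum_le_sum fun i _ => ?_
        rw [← negMulLog_mul, ← negMulLog_mul]
        exact negMulLog_add_le (mul_nonneg hs (hp i)) (mul_nonneg ht (hq i))
    _ = _ := by
        simp only [Finset.sum_add_distrib, ← Finset.sum_mul, ← Finset.mul_sum, hpsum, hqsum]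
        ring

/-- If mixing in a probability vector `q` with weight `t` lets the entropy grow by at least
`t * r`, then `t` is exponentially small in `r`. -/
lemma mix_weight_le_exp {ι : Type*} [Fintype ι] {p q : ι → ℝ} (hp : ∀ i, 0 ≤ p i)
    (hq : ∀ i, 0 ≤ q i) (hpsum : ∑ i, p i = 1) (hqsum : ∑ i, q i = 1) {s t r : ℝ} (hs : 0 ≤ s)
    (ht : 0 ≤ t) (hst : s + t = 1)
    (h : t * r ≤ ∑ i, negMulLog (s * p i + t * q i) - ∑ i, negMulLog (p i)) :
    t ≤ Fintype.card ι * exp 1 * exp (-r) := by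
  rcases ht.eq_or_lt with rfl | htpos
  · positivity
  have hp1 : ∀ i, p i ≤ 1 := fun i =>
    hpsum ▸ Finset.single_le_sum (fun j _ => hp j) (Finset.mem_univ i)
  have hp0 : 0 ≤ ∑ i, negMulLog (p i) :=
    Finset.sum_nonneg fun i _ => negMulLog_nonneg (hp i) (hp1 i)
  have hmix := sum_negMulLog_mix_le hp hq hpsum hqsum hs ht
  have hq' := mul_le_mul_of_nonneg_left (sum_negMulLog_le_log_card hq hqsum) ht
  have hs' := negMulLog_le_one_sub_self hs
  have ht' : negMulLog t = -t * log t := rfl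
  have hsp : s * ∑ i, negMulLog (p i) ≤ ∑ i, negMulLog (p i) :=
    mul_le_of_le_one_left hp0 (by linarith)
  have hlog : t * r ≤ t * (log (Fintype.card ι) + 1 - log t) := by linarith
  have hlog' := le_of_mul_le_mul_left hlog htpos
  have hne : Nonempty ι := by
    by_contra hι
    rw [not_nonempty_iff] at hι
    simp at hpsum
  have hN : (0 : ℝ) < Fintype.card ι := by exact_mod_cast Fintype.card_pos
  calc t = exp (log t) := (exp_log htpos).symm
    _ ≤ exp (log (Fintype.card ι) + 1 + -r) := exp_le_exp.2 (by linarith)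
    _ = _ := by rw [exp_add, exp_add, exp_log hN]

end Real

section TransportPolytope

variable {m n : ℕ} {a : Fin m → ℝ} {b : Fin n → ℝ}

lemma inprod_add (C X Y : Matrix (Fin m) (Fin n) ℝ) :
    inprod C (X + Y) = inprod C X + inprod C Y := by
  simp [inprod, mul_add, Finset.sum_add_distrib]

lemma inprod_smul (C X : Matrix (Fin m) (Fin n) ℝ) (r : ℝ) :
    inprod C (r • X) = r * inprod C X := by
  simp only [inprod, Matrix.smul_apply, smul_eq_mul, Finset.mul_sum]
  exact Finset.sum_congr rfl fun i _ => Finset.sum_congr rfl fun j _ => by ring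

/-- `inprod C` as a continuous linear functional. -/
def inprodCLM (C : Matrix (Fin m) (Fin n) ℝ) : Matrix (Fin m) (Fin n) ℝ →L[ℝ] ℝ where
  toFun := inprod C
  map_add' := inprod_add C
  map_smul' r X := by simp [inprod_smul]
  cont := by
    unfold inprod
    fun_prop

lemma convex_Pset : Convex ℝ (Pset a b) := by
  rintro X ⟨hX, hXa, hXb⟩ Y ⟨hY, hYa, hYb⟩ s t hs ht hst
  refine ⟨fun i j => ?_, fun i => ?_, fun j => ?_⟩
  · have := mul_nonneg hs (hX i j)
    have := mul_nonneg ht (hY i j)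
    simp only [Matrix.add_apply, Matrix.smul_apply, smul_eq_mul]
    positivity
  · simp [Finset.sum_add_distrib, ← Finset.mul_sum, hXa, hYa, ← add_mul, hst]
  · simp [Finset.sum_add_distrib, ← Finset.mul_sum, hXb, hYb, ← add_mul, hst]

lemma isCompact_Pset : IsCompact (Pset a b) := by
  have hbox : IsCompact (Set.univ.pi fun i : Fin m => Set.univ.pi fun _ : Fin n =>
      Set.Icc (0 : ℝ) (a i)) :=
    isCompact_univ_pi fun _ => isCompact_univ_pi fun _ => isCompact_Icc
  refine hbox.of_isClosed_subset ?_ ?_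
  · have h : Pset a b = (⋂ i, ⋂ j, {X : Matrix (Fin m) (Fin n) ℝ | 0 ≤ X i j}) ∩
        ((⋂ i, {X : Matrix (Fin m) (Fin n) ℝ | ∑ j, X i j = a i}) ∩
          ⋂ j, {X : Matrix (Fin m) (Fin n) ℝ | ∑ i, X i j = b j}) := by
      ext X
      simp [Pset]
    rw [h]
    refine (isClosed_iInter fun i => isClosed_iInter fun j => ?_).inter
      ((isClosed_iInter fun i => ?_).inter (isClosed_iInter fun j => ?_))
    · exact isClosed_le continuous_const (by fun_prop)
    · exact isClosed_eq (by fun_prop) continuous_const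
    · exact isClosed_eq (by fun_prop) continuous_const
  · rintro X ⟨hX, hXa, -⟩ i - j -
    exact ⟨hX i j, hXa i ▸ Finset.single_le_sum (fun k _ => hX i k) (Finset.mem_univ j)⟩

lemma sum_prod_of_mem_Pset (hasum : ∑ i, a i = 1) {X : Matrix (Fin m) (Fin n) ℝ}
    (hX : X ∈ Pset a b) : ∑ p : Fin m × Fin n, X p.1 p.2 = 1 := by
  rw [Fintype.sum_prod_type, ← hasum]
  exact Finset.sum_congr rfl fun i _ => hX.2.1 i

/-- A matrix with more than `m + n - 1` nonzero entries has a nonzero perturbation direction with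
vanishing row and column sums, supported where the matrix is nonzero. -/
lemma exists_ne_zero_of_lt_ncard_support (hn : 0 < n) {Y : Matrix (Fin m) (Fin n) ℝ}
    (h : m + n - 1 < {p : Fin m × Fin n | Y p.1 p.2 ≠ 0}.ncard) :
    ∃ Z : Matrix (Fin m) (Fin n) ℝ, Z ≠ 0 ∧ (∀ i j, Y i j = 0 → Z i j = 0) ∧
      (∀ i, ∑ j, Z i j = 0) ∧ ∀ j, ∑ i, Z i j = 0 := by
  classical
  obtain ⟨k, rfl⟩ : ∃ k, n = k + 1 := ⟨n - 1, by omega⟩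
  let S : Type := {p : Fin m × Fin (k + 1) // Y p.1 p.2 ≠ 0}
  let extend : (S → ℝ) →ₗ[ℝ] (Fin m × Fin (k + 1) → ℝ) :=
    { toFun := fun f p => if hp : Y p.1 p.2 ≠ 0 then f ⟨p, hp⟩ else 0
      map_add' := fun f g => by
        ext p
        by_cases hp : Y p.1 p.2 = 0 <;> simp [hp]
      map_smul' := fun r f => by
        ext p
        by_cases hp : Y p.1 p.2 = 0 <;> simp [hp] }
  let sums : (Fin m × Fin (k + 1) → ℝ) →ₗ[ℝ] (Fin m → ℝ) × (Fin k → ℝ) :=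
    { toFun := fun f => (fun i => ∑ j, f (i, j), fun j => ∑ i, f (i, j.castSucc))
      map_add' := fun f g => by
        ext <;> simp [Finset.sum_add_distrib]
      map_smul' := fun r f => by
        ext <;> simp [Finset.mul_sum] }
  have hcard : Module.finrank ℝ ((Fin m → ℝ) × (Fin k → ℝ)) < Module.finrank ℝ (S → ℝ) := by
    rw [Module.finrank_prod, Module.finrank_fin_fun, Module.finrank_fin_fun,
      Module.finrank_fintype_fun_eq_card, ← Nat.card_eq_fintype_card]
    exact h
  have hker := LinearMap.ker_ne_bot_of_finrank_lt (f := sums ∘ₗ extend) hcard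
  obtain ⟨f, hf, hf0⟩ := (Submodule.ne_bot_iff _).1 hker
  have hf' : sums (extend f) = 0 := hf
  have hrow : ∀ i, ∑ j, extend f (i, j) = 0 := fun i => congrFun (congrArg Prod.fst hf') i
  have hcol : ∀ j : Fin k, ∑ i, extend f (i, j.castSucc) = 0 :=
    fun j => congrFun (congrArg Prod.snd hf') j
  refine ⟨fun i j => extend f (i, j), fun hZ => hf0 ?_, fun i j hij => ?_, hrow, fun j => ?_⟩
  · ext ⟨p, hp⟩
    have := congrFun (congrFun hZ p.1) p.2
    simpa [extend, hp] using this
  · simp [extend, hij]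
  · refine Fin.lastCases ?_ hcol j
    have htot : ∑ j : Fin (k + 1), ∑ i, extend f (i, j) = 0 := by
      rw [Finset.sum_comm]
      exact Finset.sum_eq_zero fun i _ => hrow i
    rw [Fin.sum_univ_castSucc, Finset.sum_eq_zero fun j _ => hcol j, zero_add] at htot
    exact htot

/-- Small perturbations inside the support of a point of the transport polytope that preserve
the marginals stay in the polytope. -/
lemma exists_pos_add_smul_mem_Pset {Y Z : Matrix (Fin m) (Fin n) ℝ} (hY : Y ∈ Pset a b)
    (hsupp : ∀ i j, Y i j = 0 → Z i j = 0) (hrow : ∀ i, ∑ j, Z i j = 0)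
    (hcol : ∀ j, ∑ i, Z i j = 0) : ∃ ε : ℝ, 0 < ε ∧ Y + ε • Z ∈ Pset a b := by
  have hev : ∀ᶠ ε : ℝ in nhdsWithin 0 (Set.Ioi 0), ∀ i j, 0 ≤ Y i j + ε * Z i j := by
    refine Filter.eventually_all.2 fun i => Filter.eventually_all.2 fun j => ?_
    rcases (hY.1 i j).eq_or_lt with h0 | hpos
    · simp [← h0, hsupp i j h0.symm]
    · have hcont : Continuous fun ε : ℝ => Y i j + ε * Z i j := by fun_prop
      have := hcont.continuousAt.eventually (lt_mem_nhds (a := 0) (b := Y i j + 0 * Z i j)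
        (by simpa using hpos))
      exact (this.filter_mono nhdsWithin_le_nhds).mono fun _ h => h.le
  obtain ⟨ε, hε, hε0⟩ := (hev.and self_mem_nhdsWithin).exists
  refine ⟨ε, hε0, fun i j => by simpa using hε i j, fun i => ?_, fun j => ?_⟩
  · simp [Finset.sum_add_distrib, ← Finset.mul_sum, hrow, hY.2.1]
  · simp [Finset.sum_add_distrib, ← Finset.mul_sum, hcol, hY.2.2]

/-- A unique optimal transport plan has at most `m + n - 1` nonzero entries. -/
lemma ncard_support_le_of_unique_minimizer (hn : 0 < n) {C Y : Matrix (Fin m) (Fin n) ℝ}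
    (hY : Y ∈ Pset a b) (huniq : ∀ X ∈ Pset a b, inprod C X ≤ inprod C Y → X = Y) :
    {p : Fin m × Fin n | Y p.1 p.2 ≠ 0}.ncard ≤ m + n - 1 := by
  by_contra! h
  obtain ⟨Z, hZ0, hsupp, hrow, hcol⟩ := exists_ne_zero_of_lt_ncard_support hn h
  wlog hZ : inprod C Z ≤ 0 generalizing Z
  · refine this (-Z) (neg_ne_zero.2 hZ0) (fun i j hij => by simp [hsupp i j hij])
      (fun i => by simp [hrow]) (fun j => by simp [hcol]) ?_
    rw [← neg_one_smul ℝ Z, inprod_smul]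
    linarith
  obtain ⟨ε, hε, hmem⟩ := exists_pos_add_smul_mem_Pset hY hsupp hrow hcol
  have heq := huniq _ hmem (by
    rw [inprod_add, inprod_smul]
    nlinarith)
  rw [add_eq_left, smul_eq_zero] at heq
  exact heq.elim hε.ne' hZ0

lemma sum_abs_sub_le_two {X Y : Matrix (Fin m) (Fin n) ℝ} (hasum : ∑ i, a i = 1)
    (hX : X ∈ Pset a b) (hY : Y ∈ Pset a b) : ∑ i, ∑ j, |X i j - Y i j| ≤ 2 := by
  have h : ∑ i, ∑ j, |X i j - Y i j| ≤ ∑ i, ∑ j, (X i j + Y i j) :=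
    Finset.sum_le_sum fun i _ => Finset.sum_le_sum fun j _ => abs_sub_le_iff.2
      ⟨by linarith [hX.1 i j, hY.1 i j], by linarith [hX.1 i j, hY.1 i j]⟩
  simp only [Finset.sum_add_distrib, hX.2.1, hY.2.1, hasum] at h
  linarith

end TransportPolytope

/-- Core sparse-approximation bound of Theorem 2: for `η ≤ Δ/(1 + log(mn))` and any
matrix `X̃`, there is `Y` in the optimal face `𝒳` with
`‖X̃ − Y‖₁ ≤ ‖X̃ − X*(η)‖₁ + 6mn exp(−Δ/η)`; if moreover `𝒳 = {X*}` is a singleton,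
then `Y = X*` and `Y` has at most `m + n − 1` nonzero entries. -/
theorem stmt_18 {m n : ℕ} (hm : 0 < m) (hn : 0 < n)
    (a : Fin m → ℝ) (b : Fin n → ℝ)
    (ha : ∀ i, 0 < a i) (hb : ∀ j, 0 < b j)
    (hasum : ∑ i, a i = 1) (hbsum : ∑ j, b j = 1)
    (C : Matrix (Fin m) (Fin n) ℝ)
    (cstar : ℝ) (hc : IsLeast ((fun X => inprod C X) '' Pset a b) cstar)
    (Δ : ℝ)
    (hΔ : IsLeast
      {d : ℝ | ∃ v ∈ Set.extremePoints ℝ (Pset a b),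
        cstar < inprod C v ∧ d = inprod C v - cstar} Δ)
    (η : ℝ) (hη : 0 < η) (hsmall : η ≤ Δ / (1 + Real.log ((m : ℝ) * n)))
    (Xs : Matrix (Fin m) (Fin n) ℝ) (hXsP : Xs ∈ Pset a b)
    (hXsmin : ∀ X ∈ Pset a b,
      inprod C Xs + η * ∑ i, ∑ j, Xs i j * Real.log (Xs i j)
        ≤ inprod C X + η * ∑ i, ∑ j, X i j * Real.log (X i j))
    (hXsuniq : ∀ Y ∈ Pset a b,
      (∀ X ∈ Pset a b,
        inprod C Y + η * ∑ i, ∑ j, Y i j * Real.log (Y i j)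
          ≤ inprod C X + η * ∑ i, ∑ j, X i j * Real.log (X i j)) → Y = Xs)
    (Xtilde : Matrix (Fin m) (Fin n) ℝ) :
    ∃ Y, (Y ∈ Pset a b ∧ inprod C Y = cstar) ∧
      (∑ i, ∑ j, |Xtilde i j - Y i j|)
        ≤ (∑ i, ∑ j, |Xtilde i j - Xs i j|) + 6 * (m : ℝ) * n * Real.exp (-Δ / η) ∧
      (∀ Xstar : Matrix (Fin m) (Fin n) ℝ,
        {X ∈ Pset a b | inprod C X = cstar} = {Xstar} →
        Y = Xstar ∧ {p : Fin m × Fin n | Y p.1 p.2 ≠ 0}.ncard ≤ m + n - 1) := by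
  obtain ⟨⟨X₀, hX₀, hX₀c⟩, hlow⟩ := hc
  have hmin : ∀ X ∈ Pset a b, cstar ≤ inprod C X := fun X hX => hlow ⟨X, hX, rfl⟩
  obtain ⟨⟨v₀, hv₀, -, hv₀Δ⟩, hΔmin⟩ := hΔ
  have : LocallyConvexSpace ℝ (Matrix (Fin m) (Fin n) ℝ) :=
    inferInstanceAs (LocallyConvexSpace ℝ (Fin m → Fin n → ℝ))
  obtain ⟨Y, hY, hYc, Z, hZ, hZc, s, t, hs, ht, hst, hXs⟩ :=
    exists_segment_of_extremePoints isCompact_Pset convex_Pset (inprodCLM C)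
      (c := cstar) (d := cstar + Δ)
      (fun v hv => by
        rcases (hmin v (extremePoints_subset hv)).eq_or_lt with h | h
        · exact Or.inl h.symm
        · have := hΔmin ⟨v, hv, h, rfl⟩
          exact Or.inr (by change cstar + Δ ≤ inprod C v; linarith))
      ⟨X₀, hX₀, hX₀c⟩
      ⟨v₀, extremePoints_subset hv₀, by change cstar + Δ ≤ inprod C v₀; linarith⟩ hXsP
  change inprod C Y = cstar at hYc
  change cstar + Δ ≤ inprod C Z at hZc
  have hXs' : ∀ i j, Xs i j = s * Y i j + t * Z i j := fun i j => by simp [← hXs]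
  have hcost : cstar + t * Δ ≤ inprod C Xs := by
    rw [← hXs, inprod_add, inprod_smul, inprod_smul, hYc]
    have := mul_le_mul_of_nonneg_left hZc ht
    have : s * cstar + t * cstar = cstar := by rw [← add_mul, hst, one_mul]
    linarith
  have hent : ∀ X : Matrix (Fin m) (Fin n) ℝ, ∑ i, ∑ j, X i j * Real.log (X i j) =
      -∑ p : Fin m × Fin n, Real.negMulLog (X p.1 p.2) := fun X => by
    simp [Real.negMulLog, Fintype.sum_prod_type]
  have hgain : t * (Δ / η) ≤
      ∑ p : Fin m × Fin n, Real.negMulLog (s * Y p.1 p.2 + t * Z p.1 p.2) -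
        ∑ p : Fin m × Fin n, Real.negMulLog (Y p.1 p.2) := by
    have h := hXsmin Y hY
    rw [hent, hent, hYc] at h
    simp only [← hXs']
    rw [← mul_div_assoc, div_le_iff₀ hη]
    linarith
  have hweight := Real.mix_weight_le_exp (fun p : Fin m × Fin n => hY.1 p.1 p.2)
    (fun p => hZ.1 p.1 p.2) (sum_prod_of_mem_Pset hasum hY) (sum_prod_of_mem_Pset hasum hZ)
    hs ht hst hgain
  rw [Fintype.card_prod, Fintype.card_fin, Fintype.card_fin, Nat.cast_mul, ← neg_div] at hweight
  have hdist : ∑ i, ∑ j, |Xs i j - Y i j| ≤ t * 2 := by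
    have h : ∀ i j, |Xs i j - Y i j| = t * |Z i j - Y i j| := fun i j => by
      rw [hXs', ← abs_of_nonneg ht, ← abs_mul, abs_of_nonneg ht, eq_sub_of_add_eq hst]
      ring_nf
    simp only [h, ← Finset.mul_sum]
    exact mul_le_mul_of_nonneg_left (sum_abs_sub_le_two hasum hZ hY) ht
  refine ⟨Y, ⟨hY, hYc⟩, ?_, fun Xstar hXstar => ?_⟩
  · have htri : ∑ i, ∑ j, |Xtilde i j - Y i j| ≤
        ∑ i, ∑ j, |Xtilde i j - Xs i j| + ∑ i, ∑ j, |Xs i j - Y i j| := by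
      simp only [← Finset.sum_add_distrib]
      exact Finset.sum_le_sum fun i _ => Finset.sum_le_sum fun j _ => abs_sub_le _ _ _
    have hexp : (m : ℝ) * n * Real.exp 1 * Real.exp (-Δ / η) ≤
        3 * (m : ℝ) * n * Real.exp (-Δ / η) := by
      have := mul_le_mul_of_nonneg_left Real.exp_one_lt_three.le
        (show 0 ≤ (m : ℝ) * n * Real.exp (-Δ / η) by positivity)
      linarith
    linarith
  · have hYstar : Y = Xstar := hXstar.subset ⟨hY, hYc⟩
    refine ⟨hYstar, ncard_support_le_of_unique_minimizer (C := C) hn hY fun X hX hXY => ?_⟩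
    rw [hYstar]
    exact hXstar.subset ⟨hX, le_antisymm (hXY.trans hYc.le) (hmin X hX)⟩
end
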